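/- arXiv:2505.02058 — 3 statements merged into one kernel-verified Lean document; each statement's English description precedes it below -/
import Mathlib

section
/- Let c ∈ (0,1) and let (k_n) be a sequence of integers with 0 ≤ k_n ≤ n, k_n ≠ n−1 for all n, and lim_{n→∞} k_n/n = c. Then lim_{n→∞} (1/(n²·d_{n,k_n}))·∑_{σ ∈ D_{n,k_n}} I(σ) = (3 − 2c − c²)/12. -/
/-- Number of inversions of a permutation of `Fin n`: the number of pairs of
positions `a < b` with `σ a > σ b`. -/
def inversions {n : ℕ} (σ : Equiv.Perm (Fin n)) : ℕ :=
  ((Finset.univ : Finset (Fin n × Fin n)).filter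
    (fun p => p.1 < p.2 ∧ σ p.2 < σ p.1)).card

/-- The set of derangements (fixed-point-free permutations) of `Fin n`. -/
def derangeSet (n : ℕ) : Finset (Equiv.Perm (Fin n)) :=
  Finset.univ.filter (fun σ => ∀ x, σ x ≠ x)

/-- The number of derangements of `Fin n` (so `numDerange 0 = 1`). -/
def numDerange (n : ℕ) : ℕ := (derangeSet n).card

/-- The number of fixed points of a permutation of `Fin n`. -/
def fixedPointCount {n : ℕ} (σ : Equiv.Perm (Fin n)) : ℕ :=
  (Finset.univ.filter (fun x => σ x = x)).card

/-- The set of permutations of `Fin n` with exactly `k` fixed points. -/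
def permsWithFixed (n k : ℕ) : Finset (Equiv.Perm (Fin n)) :=
  Finset.univ.filter (fun σ => fixedPointCount σ = k)

/-- The number of permutations of `Fin n` with exactly `k` fixed points. -/
def numPermsWithFixed (n k : ℕ) : ℕ := (permsWithFixed n k).card

theorem sum_perm_mul_right {α : Type*} [Fintype α] [DecidableEq α] (π : Equiv.Perm α)
    (F : Equiv.Perm α → ℝ) : ∑ τ, F (τ * π) = ∑ τ, F τ :=
  Equiv.sum_comp (Equiv.mulRight π) F

/-- A uniformly random permutation orders three distinct points in a prescribed way
with probability `1 / 6`. -/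
theorem six_mul_sum_lt_lt {n : ℕ} {x y z : Fin n} (hxy : x ≠ y) (hxz : x ≠ z) (hyz : y ≠ z) :
    6 * ∑ τ : Equiv.Perm (Fin n), (if τ x < τ y ∧ τ y < τ z then (1 : ℝ) else 0) =
      (n.factorial : ℝ) := by
  set F : Equiv.Perm (Fin n) → ℝ := fun τ => if τ x < τ y ∧ τ y < τ z then 1 else 0 with hF
  have key : ∀ τ : Equiv.Perm (Fin n), F τ + F (τ * Equiv.swap x y) + F (τ * Equiv.swap y z) +
      F (τ * Equiv.swap x z) + F (τ * (Equiv.swap x y * Equiv.swap y z)) +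
      F (τ * (Equiv.swap y z * Equiv.swap x y)) = 1 := by
    intro τ
    have h1 : τ x ≠ τ y := τ.injective.ne hxy
    have h2 : τ x ≠ τ z := τ.injective.ne hxz
    have h3 : τ y ≠ τ z := τ.injective.ne hyz
    simp only [hF, Equiv.Perm.mul_apply, Equiv.swap_apply_left, Equiv.swap_apply_right,
      Equiv.swap_apply_of_ne_of_ne hxy hxz, Equiv.swap_apply_of_ne_of_ne hxy.symm hyz,
      Equiv.swap_apply_of_ne_of_ne hxz.symm hyz.symm]
    rcases lt_or_gt_of_ne h1 with h1 | h1 <;> rcases lt_or_gt_of_ne h2 with h2 | h2 <;>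
      rcases lt_or_gt_of_ne h3 with h3 | h3 <;>
      first
      | (exfalso; order)
      | simp [h1, h2, h3, h1.not_gt, h2.not_gt, h3.not_gt]
  have := Finset.sum_congr (rfl : (Finset.univ : Finset (Equiv.Perm (Fin n))) = _)
    fun τ _ => key τ
  simp only [Finset.sum_add_distrib, sum_perm_mul_right _ F, Finset.sum_const, Finset.card_univ,
    Fintype.card_perm, Fintype.card_fin, nsmul_eq_mul, mul_one] at this
  linarith

/-- For a uniformly random permutation, the relative orders of the images of two disjoint pairs of
points are independent and fair. -/
theorem four_mul_sum_lt_and_lt {n : ℕ} {a b c d : Fin n} (hab : a ≠ b) (hcd : c ≠ d)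
    (hac : a ≠ c) (had : a ≠ d) (hbc : b ≠ c) (hbd : b ≠ d) :
    4 * ∑ τ : Equiv.Perm (Fin n), (if τ a < τ b ∧ τ c < τ d then (1 : ℝ) else 0) =
      (n.factorial : ℝ) := by
  set F : Equiv.Perm (Fin n) → ℝ := fun τ => if τ a < τ b ∧ τ c < τ d then 1 else 0 with hF
  have key : ∀ τ : Equiv.Perm (Fin n), F τ + F (τ * Equiv.swap a b) + F (τ * Equiv.swap c d) +
      F (τ * (Equiv.swap a b * Equiv.swap c d)) = 1 := by
    intro τ
    have h1 : τ a ≠ τ b := τ.injective.ne hab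
    have h2 : τ c ≠ τ d := τ.injective.ne hcd
    simp only [hF, Equiv.Perm.mul_apply, Equiv.swap_apply_left, Equiv.swap_apply_right,
      Equiv.swap_apply_of_ne_of_ne hac had, Equiv.swap_apply_of_ne_of_ne hbc hbd,
      Equiv.swap_apply_of_ne_of_ne hac.symm hbc.symm,
      Equiv.swap_apply_of_ne_of_ne had.symm hbd.symm]
    rcases lt_or_gt_of_ne h1 with h1 | h1 <;> rcases lt_or_gt_of_ne h2 with h2 | h2 <;>
      simp [h1, h2, h1.not_gt, h2.not_gt]
  have := Finset.sum_congr (rfl : (Finset.univ : Finset (Equiv.Perm (Fin n))) = _)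
    fun τ _ => key τ
  simp only [Finset.sum_add_distrib, sum_perm_mul_right _ F, Finset.sum_const, Finset.card_univ,
    Fintype.card_perm, Fintype.card_fin, nsmul_eq_mul, mul_one] at this
  linarith

theorem inversions_conj {n : ℕ} (σ τ : Equiv.Perm (Fin n)) :
    (inversions (τ * σ * τ⁻¹) : ℝ) =
      ∑ a, ∑ b, if τ a < τ b ∧ τ (σ b) < τ (σ a) then (1 : ℝ) else 0 := by
  rw [inversions, Finset.card_filter, Nat.cast_sum, Fintype.sum_prod_type,
    ← Equiv.sum_comp τ]
  refine Finset.sum_congr rfl fun a _ => ?_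
  rw [← Equiv.sum_comp τ]
  simp

/-- The number of `τ` for which `(τ a, τ b)` is an inversion of `τ σ τ⁻¹`, up to an error
supported on the coincidences `a = b`, `σ a = b`, `σ b = a`. -/
theorem abs_twelve_mul_sum_inversion_sub_le {n : ℕ} (σ : Equiv.Perm (Fin n)) (e : Fin n → ℝ)
    (he : ∀ a, e a = if σ a = a then 1 else 0) (a b : Fin n) :
    |12 * ∑ τ : Equiv.Perm (Fin n), (if τ a < τ b ∧ τ (σ b) < τ (σ a) then (1 : ℝ) else 0) -
      n.factorial * (2 * (e a * (1 - e b)) + 2 * ((1 - e a) * e b) +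
        3 * ((1 - e a) * (1 - e b)))| ≤
      12 * n.factorial * ((if a = b then 1 else 0) + (if σ a = b then 1 else 0) +
        (if σ b = a then 1 else 0)) := by
  set S := ∑ τ : Equiv.Perm (Fin n), (if τ a < τ b ∧ τ (σ b) < τ (σ a) then (1 : ℝ) else 0)
  have hN : (0 : ℝ) ≤ n.factorial := Nat.cast_nonneg _
  by_cases hgood : a ≠ b ∧ σ a ≠ b ∧ σ b ≠ a
  · obtain ⟨hab, hσa, hσb⟩ := hgood
    have hσ : σ a ≠ σ b := σ.injective.ne hab
    suffices h : 12 * S = n.factorial * (2 * (e a * (1 - e b)) + 2 * ((1 - e a) * e b) +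
        3 * ((1 - e a) * (1 - e b))) by
      simp [h, hab, hσa, hσb]
    by_cases ha : σ a = a <;> by_cases hb : σ b = b
    · have : S = 0 := Finset.sum_eq_zero fun τ _ => by
        rw [ha, hb, if_neg fun h => h.1.not_gt h.2]
      simp [this, he, ha, hb]
    · have := six_mul_sum_lt_lt hσb (fun h => hb h) hab
      have hS : S = ∑ τ : Equiv.Perm (Fin n),
          (if τ (σ b) < τ a ∧ τ a < τ b then (1 : ℝ) else 0) :=
        Finset.sum_congr rfl fun τ _ => by simp only [ha, and_comm]
      simp only [he, ha, hb, if_true, if_false]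
      linarith
    · have := six_mul_sum_lt_lt hab (fun h => ha h.symm) hσa.symm
      have hS : S = ∑ τ : Equiv.Perm (Fin n),
          (if τ a < τ b ∧ τ b < τ (σ a) then (1 : ℝ) else 0) :=
        Finset.sum_congr rfl fun τ _ => by rw [hb]
      simp only [he, ha, hb, if_true, if_false]
      linarith
    · have : 4 * S = n.factorial := four_mul_sum_lt_and_lt hab hσ.symm hσb.symm
        (fun h => ha h.symm) (fun h => hb h.symm) hσa.symm
      simp only [he, ha, hb, if_false]
      linarith
  · have hS0 : 0 ≤ S := Finset.sum_nonneg fun τ _ => by split_ifs <;> norm_num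
    have hS1 : S ≤ n.factorial := by
      calc S ≤ ∑ _τ : Equiv.Perm (Fin n), (1 : ℝ) :=
            Finset.sum_le_sum fun τ _ => by split_ifs <;> norm_num
        _ = n.factorial := by simp [Fintype.card_perm]
    have hE : (1 : ℝ) ≤ (if a = b then 1 else 0) + (if σ a = b then 1 else 0) +
        (if σ b = a then 1 else 0) := by
      have : a = b ∨ σ a = b ∨ σ b = a := by tauto
      split_ifs <;> first | tauto | norm_num
    refine le_trans ?_ (le_mul_of_one_le_right (by positivity) hE)
    rw [abs_le, he, he]
    split_ifs <;> constructor <;> linarith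

/-- The average number of inversions over the conjugates of `σ`, up to a linear error. -/
theorem abs_sum_inversions_conj_sub_le {n k : ℕ} {σ : Equiv.Perm (Fin n)}
    (hσ : fixedPointCount σ = k) :
    |12 * ∑ τ : Equiv.Perm (Fin n), (inversions (τ * σ * τ⁻¹) : ℝ) -
      n.factorial * ((n - k) * (3 * n + k))| ≤ 36 * n.factorial * n := by
  set e : Fin n → ℝ := fun a => if σ a = a then 1 else 0 with he
  have hek : ∑ a, e a = k := by
    rw [← hσ, fixedPointCount, Finset.card_filter]
    simp [he]
  have hmain : ∑ a, ∑ b, (2 * (e a * (1 - e b)) + 2 * ((1 - e a) * e b) +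
      3 * ((1 - e a) * (1 - e b))) = (n - k) * (3 * n + k) := by
    have h1 : ∑ a, (1 - e a) = n - k := by simp [Finset.sum_sub_distrib, hek]
    simp only [Finset.sum_add_distrib, ← Finset.mul_sum, ← Finset.sum_mul, h1, hek]
    ring
  have hS : ∑ τ : Equiv.Perm (Fin n), (inversions (τ * σ * τ⁻¹) : ℝ) = ∑ a, ∑ b,
      ∑ τ : Equiv.Perm (Fin n), if τ a < τ b ∧ τ (σ b) < τ (σ a) then (1 : ℝ) else 0 := by
    simp only [inversions_conj]
    rw [Finset.sum_comm]
    exact Finset.sum_congr rfl fun a _ => Finset.sum_comm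
  have herr : ∑ a, ∑ b, 12 * (n.factorial : ℝ) * ((if a = b then 1 else 0) +
      (if σ a = b then 1 else 0) + (if σ b = a then 1 else 0)) = 36 * n.factorial * n := by
    have h3 : ∑ a, ∑ b, (if σ b = a then (1 : ℝ) else 0) = n := by
      rw [Finset.sum_comm]; simp
    simp only [← Finset.mul_sum, Finset.sum_add_distrib, h3]
    simp
    ring
  rw [hS, ← hmain, ← herr]
  simp only [Finset.mul_sum, ← Finset.sum_sub_distrib]
  refine (Finset.abs_sum_le_sum_abs _ _).trans (Finset.sum_le_sum fun a _ => ?_)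
  refine (Finset.abs_sum_le_sum_abs _ _).trans (Finset.sum_le_sum fun b _ => ?_)
  simpa only [Finset.mul_sum] using abs_twelve_mul_sum_inversion_sub_le σ e (fun _ => rfl) a b

theorem fixedPointCount_conj {n : ℕ} (σ τ : Equiv.Perm (Fin n)) :
    fixedPointCount (τ * σ * τ⁻¹) = fixedPointCount σ := by
  unfold fixedPointCount
  symm
  exact Finset.card_equiv τ fun a => by rw [Finset.mem_filter, Finset.mem_filter]; simp

theorem sum_permsWithFixed_conj {n : ℕ} (k : ℕ) (τ : Equiv.Perm (Fin n))
    (f : Equiv.Perm (Fin n) → ℝ) :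
    ∑ σ ∈ permsWithFixed n k, f (τ * σ * τ⁻¹) = ∑ σ ∈ permsWithFixed n k, f σ :=
  Finset.sum_equiv (MulAut.conj τ).toEquiv
    (fun σ => by simp [permsWithFixed, fixedPointCount_conj]) fun σ _ => by simp

theorem abs_sum_inversions_permsWithFixed_sub_le (n k : ℕ) :
    |12 * ∑ σ ∈ permsWithFixed n k, (inversions σ : ℝ) -
      numPermsWithFixed n k * ((n - k) * (3 * n + k))| ≤ 36 * n * numPermsWithFixed n k := by
  have hN : (0 : ℝ) < n.factorial := by positivity
  have hswap : ∑ σ ∈ permsWithFixed n k, ∑ τ : Equiv.Perm (Fin n),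
      (inversions (τ * σ * τ⁻¹) : ℝ) =
      n.factorial * ∑ σ ∈ permsWithFixed n k, (inversions σ : ℝ) := by
    rw [Finset.sum_comm]
    simp [sum_permsWithFixed_conj k _ fun σ => (inversions σ : ℝ), Fintype.card_perm]
  have hsum := (Finset.abs_sum_le_sum_abs _ _).trans (Finset.sum_le_sum
    fun σ (hσ : σ ∈ permsWithFixed n k) =>
      abs_sum_inversions_conj_sub_le (Finset.mem_filter.mp hσ).2)
  rw [Finset.sum_sub_distrib, ← Finset.mul_sum, hswap, Finset.sum_const, Finset.sum_const,
    nsmul_eq_mul, nsmul_eq_mul] at hsum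
  refine le_of_mul_le_mul_left ?_ hN
  rw [← abs_of_pos hN, ← abs_mul, abs_of_pos hN]
  convert hsum using 1
  · rw [numPermsWithFixed]; congr 1; ring
  · rw [numPermsWithFixed]; ring

theorem numPermsWithFixed_pos {n k : ℕ} (h : k + 2 ≤ n) : 0 < numPermsWithFixed n k := by
  obtain ⟨g, hg⟩ := (Equiv.Perm.exists_with_cycleType_iff (α := Fin n) (m := {n - k})).mpr
    ⟨by simp, by simp; omega⟩
  have hsupp : g.support.card = n - k := by rw [← Equiv.Perm.sum_cycleType, hg]; simp
  refine Finset.card_pos.mpr ⟨g, Finset.mem_filter.mpr ⟨Finset.mem_univ _, ?_⟩⟩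
  have hcompl : Finset.univ.filter (fun x => g x = x) = g.supportᶜ := by ext x; simp
  rw [fixedPointCount, hcompl, Finset.card_compl, hsupp, Fintype.card_fin]
  omega

/-- If `k n / n → c ∈ (0,1)`, then the expected number of inversions of a uniformly
random permutation with `k n` fixed points, divided by `n²`, tends to `(3-2c-c²)/12`. -/
theorem stmt4 (c : ℝ) (hc0 : 0 < c) (hc1 : c < 1) (k : ℕ → ℕ)
    (hk : ∀ n, k n ≤ n) (hk' : ∀ n, k n + 1 ≠ n)
    (hlim : Filter.Tendsto (fun n => (k n : ℝ) / (n : ℝ)) Filter.atTop (nhds c)) :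
    Filter.Tendsto
      (fun n : ℕ => (1 / ((n : ℝ) ^ 2 * (numPermsWithFixed n (k n) : ℝ))) *
        ∑ σ ∈ permsWithFixed n (k n), (inversions σ : ℝ))
      Filter.atTop (nhds ((3 - 2 * c - c ^ 2) / 12)) := by
  have hN : Filter.Tendsto (fun n : ℕ => (n : ℝ)) Filter.atTop Filter.atTop :=
    tendsto_natCast_atTop_atTop
  have hmain : Filter.Tendsto
      (fun n : ℕ => (1 - (k n : ℝ) / n) * (3 + (k n : ℝ) / n) / 12) Filter.atTop
      (nhds ((3 - 2 * c - c ^ 2) / 12)) := by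
    convert ((hlim.const_sub 1).mul (hlim.const_add 3)).div_const 12 using 2
    ring
  have herr : Filter.Tendsto (fun n : ℕ => 3 / (n : ℝ)) Filter.atTop (nhds 0) :=
    hN.const_div_atTop 3
  have hpos : ∀ᶠ n : ℕ in Filter.atTop, 0 < n ∧ 0 < numPermsWithFixed n (k n) := by
    filter_upwards [hlim.eventually_lt_const hc1, Filter.eventually_gt_atTop 0] with n hn hn0
    have hn0' : (0 : ℝ) < n := Nat.cast_pos.mpr hn0
    rw [div_lt_one hn0', Nat.cast_lt] at hn
    have := hk' n
    exact ⟨hn0, numPermsWithFixed_pos (by omega)⟩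
  refine tendsto_of_tendsto_of_dist hmain (squeeze_zero' (.of_forall fun _ => dist_nonneg) ?_ herr)
  filter_upwards [hpos] with n ⟨hn, hd⟩
  have hn : (0 : ℝ) < n := Nat.cast_pos.mpr hn
  have hd : (0 : ℝ) < numPermsWithFixed n (k n) := Nat.cast_pos.mpr hd
  have h := abs_sum_inversions_permsWithFixed_sub_le n (k n)
  rw [dist_comm, Real.dist_eq]
  set S := ∑ σ ∈ permsWithFixed n (k n), (inversions σ : ℝ)
  set d := (numPermsWithFixed n (k n) : ℝ)
  have hrw : 1 / ((n : ℝ) ^ 2 * d) * S - (1 - (k n : ℝ) / n) * (3 + (k n : ℝ) / n) / 12 =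
      (12 * S - d * ((n - k n) * (3 * n + k n))) / (12 * n ^ 2 * d) := by
    field_simp
  have hden : 0 < 12 * (n : ℝ) ^ 2 * d := by positivity
  rw [hrw, abs_div, abs_of_pos hden, div_le_div_iff₀ hden hn]
  nlinarith [mul_le_mul_of_nonneg_right h hn.le]
end

section
/- The weak law of large numbers holds for the inversion statistic on random derangements: for every ε > 0, lim_{n→∞} #{σ ∈ D_n : (1−ε)·n²/4 ≤ I(σ) ≤ (1+ε)·n²/4} / d_n = 1. -/
open Finset in
theorem card_fst_lt_snd (n : ℕ) :
    2 * #{p : Fin n × Fin n | p.1 < p.2} + n = n ^ 2 := by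
  have hswap : #{p : Fin n × Fin n | p.1 < p.2} = #{p : Fin n × Fin n | p.2 < p.1} :=
    card_equiv (Equiv.prodComm _ _) (by simp)
  have hdiag : #{p : Fin n × Fin n | p.1 = p.2} = n := by
    have h := (univ : Finset (Fin n)).diag_card
    rw [card_univ, Fintype.card_fin] at h
    refine (congrArg card (Finset.ext fun p => ?_)).trans h
    simp
  have hlt := card_filter_add_card_filter_not (s := (univ : Finset (Fin n × Fin n)))
    (fun p => p.1 < p.2)
  have hle := card_filter_add_card_filter_not
    (s := ({p : Fin n × Fin n | ¬ p.1 < p.2} : Finset _)) (fun p => p.1 = p.2)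
  rw [filter_filter, filter_filter] at hle
  have h₁ : #{p : Fin n × Fin n | ¬ p.1 < p.2 ∧ p.1 = p.2} = n := by
    refine (congrArg card (Finset.ext fun p => ?_)).trans hdiag
    simp only [mem_filter, mem_univ, true_and]
    exact ⟨fun h => h.2, fun h => ⟨h.not_lt, h⟩⟩
  have h₂ : #{p : Fin n × Fin n | ¬ p.1 < p.2 ∧ ¬ p.1 = p.2} =
      #{p : Fin n × Fin n | p.2 < p.1} := by
    refine congrArg card (Finset.ext fun p => ?_)
    simp only [mem_filter, mem_univ, true_and]
    omega
  simp only [card_univ, Fintype.card_prod, Fintype.card_fin] at hlt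
  rw [pow_two]
  omega

/-- The sign recording whether the pair of positions `p` is inverted by `σ`;
it is zero unless `p` is increasing. -/
def inversionSign {n : ℕ} (σ : Equiv.Perm (Fin n)) (p : Fin n × Fin n) : ℝ :=
  if p.1 < p.2 then (if σ p.2 < σ p.1 then 1 else -1) else 0

theorem abs_inversionSign_le_one {n : ℕ} (σ : Equiv.Perm (Fin n)) (p : Fin n × Fin n) :
    |inversionSign σ p| ≤ 1 := by
  unfold inversionSign
  split_ifs <;> simp

open Finset in
theorem sum_inversionSign {n : ℕ} (σ : Equiv.Perm (Fin n)) :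
    ∑ p, inversionSign σ p = 2 * (inversions σ : ℝ) - ((n : ℝ) ^ 2 - n) / 2 := by
  have hcard : 2 * (#{p : Fin n × Fin n | p.1 < p.2} : ℝ) + n = (n : ℝ) ^ 2 := by
    exact_mod_cast card_fst_lt_snd n
  have hsplit : ∀ p, inversionSign σ p =
      2 * (if p.1 < p.2 ∧ σ p.2 < σ p.1 then 1 else 0) - (if p.1 < p.2 then 1 else 0) := by
    intro p
    unfold inversionSign
    by_cases h₁ : p.1 < p.2 <;> by_cases h₂ : σ p.2 < σ p.1 <;> simp [h₁, h₂]
    norm_num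
  simp only [hsplit, sum_sub_distrib, ← mul_sum, sum_boole]
  unfold inversions
  linarith

theorem inversionSign_mul_swap {n : ℕ} (σ : Equiv.Perm (Fin n)) (p : Fin n × Fin n) :
    inversionSign (σ * Equiv.swap p.1 p.2) p = -inversionSign σ p := by
  unfold inversionSign
  by_cases h : p.1 < p.2
  · have hne : σ p.1 ≠ σ p.2 := fun he => h.ne (σ.injective he)
    rcases lt_or_gt_of_ne hne with h' | h' <;> simp [h, h', h'.not_gt]
  · simp [h]

theorem inversionSign_mul_swap_of_ne {n : ℕ} (σ : Equiv.Perm (Fin n)) {a b : Fin n}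
    {q : Fin n × Fin n} (h₁ : q.1 ≠ a) (h₂ : q.1 ≠ b) (h₃ : q.2 ≠ a) (h₄ : q.2 ≠ b) :
    inversionSign (σ * Equiv.swap a b) q = inversionSign σ q := by
  simp [inversionSign, Equiv.swap_apply_of_ne_of_ne, h₁, h₂, h₃, h₄]

theorem sum_inversionSign_mul_eq_zero {n : ℕ} {p q : Fin n × Fin n} (h₁ : q.1 ≠ p.1)
    (h₂ : q.1 ≠ p.2) (h₃ : q.2 ≠ p.1) (h₄ : q.2 ≠ p.2) :
    ∑ σ : Equiv.Perm (Fin n), inversionSign σ p * inversionSign σ q = 0 := by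
  have h := Equiv.sum_comp (Equiv.mulRight (Equiv.swap p.1 p.2))
    (fun σ => inversionSign σ p * inversionSign σ q)
  simp only [Equiv.coe_mulRight, inversionSign_mul_swap,
    inversionSign_mul_swap_of_ne _ h₁ h₂ h₃ h₄, neg_mul, Finset.sum_neg_distrib] at h
  linarith

open Finset in
theorem sum_inversionSign_mul_le {n : ℕ} (p q : Fin n × Fin n) :
    ∑ σ : Equiv.Perm (Fin n), inversionSign σ p * inversionSign σ q ≤
      (n.factorial : ℝ) * ((if q.1 = p.1 then 1 else 0) + (if q.1 = p.2 then 1 else 0) +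
        (if q.2 = p.1 then 1 else 0) + (if q.2 = p.2 then 1 else 0)) := by
  by_cases h : q.1 ≠ p.1 ∧ q.1 ≠ p.2 ∧ q.2 ≠ p.1 ∧ q.2 ≠ p.2
  · obtain ⟨h₁, h₂, h₃, h₄⟩ := h
    rw [sum_inversionSign_mul_eq_zero h₁ h₂ h₃ h₄]
    simp [h₁, h₂, h₃, h₄]
  · have hle : ∑ σ : Equiv.Perm (Fin n), inversionSign σ p * inversionSign σ q ≤
        (n.factorial : ℝ) := by
      calc ∑ σ : Equiv.Perm (Fin n), inversionSign σ p * inversionSign σ q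
          ≤ ∑ _σ : Equiv.Perm (Fin n), (1 : ℝ) := by
            refine sum_le_sum fun σ _ => (le_abs_self _).trans ?_
            rw [abs_mul]
            exact mul_le_one₀ (abs_inversionSign_le_one σ p) (abs_nonneg _)
              (abs_inversionSign_le_one σ q)
        _ = n.factorial := by simp [Fintype.card_perm]
    refine hle.trans (le_mul_of_one_le_right (by positivity) ?_)
    split_ifs <;> first | (exfalso; tauto) | norm_num

open Finset in
theorem sum_sq_sum_inversionSign_le (n : ℕ) :
    ∑ σ : Equiv.Perm (Fin n), (∑ p, inversionSign σ p) ^ 2 ≤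
      (n.factorial : ℝ) * (4 * (n : ℝ) ^ 3) := by
  calc ∑ σ : Equiv.Perm (Fin n), (∑ p, inversionSign σ p) ^ 2
      = ∑ p, ∑ q, ∑ σ : Equiv.Perm (Fin n), inversionSign σ p * inversionSign σ q := by
        simp only [pow_two, sum_mul_sum]
        rw [sum_comm]
        exact sum_congr rfl fun p _ => sum_comm
    _ ≤ ∑ p : Fin n × Fin n, ∑ q : Fin n × Fin n,
        (n.factorial : ℝ) * ((if q.1 = p.1 then 1 else 0) + (if q.1 = p.2 then 1 else 0) +
        (if q.2 = p.1 then 1 else 0) + (if q.2 = p.2 then 1 else 0)) :=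
        sum_le_sum fun p _ => sum_le_sum fun q _ => sum_inversionSign_mul_le p q
    _ = (n.factorial : ℝ) * (4 * (n : ℝ) ^ 3) := by
        simp only [← mul_sum]
        congr 1
        have hfst (a : Fin n) : ∑ q : Fin n × Fin n, (if q.1 = a then (1 : ℝ) else 0) = n := by
          rw [Fintype.sum_prod_type_right]
          simp only [sum_ite_eq', mem_univ, if_true]
          simp
        have hsnd (a : Fin n) : ∑ q : Fin n × Fin n, (if q.2 = a then (1 : ℝ) else 0) = n := by
          rw [Fintype.sum_prod_type]
          simp only [sum_ite_eq', mem_univ, if_true]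
          simp
        simp only [sum_add_distrib, hfst, hsnd, sum_const, card_univ, Fintype.card_prod,
          Fintype.card_fin, nsmul_eq_mul]
        push_cast
        ring

open Finset in
theorem card_inversions_deviation_le {n : ℕ} {ε : ℝ} (hε : 0 < ε) (hn : 2 ≤ ε * n) :
    (#{σ : Equiv.Perm (Fin n) | ¬ ((1 - ε) * (n : ℝ) ^ 2 / 4 ≤ (inversions σ : ℝ) ∧
        (inversions σ : ℝ) ≤ (1 + ε) * (n : ℝ) ^ 2 / 4)} : ℝ) / n.factorial ≤
      64 / ε ^ 2 / n := by
  set B : Finset (Equiv.Perm (Fin n)) :=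
    {σ | ¬ ((1 - ε) * (n : ℝ) ^ 2 / 4 ≤ (inversions σ : ℝ) ∧
        (inversions σ : ℝ) ≤ (1 + ε) * (n : ℝ) ^ 2 / 4)} with hB
  have hn0 : (0 : ℝ) < n := by
    by_contra! h
    nlinarith
  have hdev : ∀ σ ∈ B, (ε * (n : ℝ) ^ 2 / 4) ^ 2 ≤ (∑ p, inversionSign σ p) ^ 2 := by
    intro σ hσ
    rw [hB, mem_filter, not_and_or, not_le, not_le] at hσ
    have hn2 : 2 * (n : ℝ) ≤ ε * (n : ℝ) ^ 2 := by nlinarith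
    have hpos : 0 ≤ ε * (n : ℝ) ^ 2 := by positivity
    rw [sum_inversionSign, sq_le_sq, abs_of_nonneg (by positivity), le_abs]
    rcases hσ.2 with h | h
    · right
      linarith
    · left
      linarith
  have hcheb : (#B : ℝ) * (ε * (n : ℝ) ^ 2 / 4) ^ 2 ≤ (n.factorial : ℝ) * (4 * (n : ℝ) ^ 3) :=
    calc (#B : ℝ) * (ε * (n : ℝ) ^ 2 / 4) ^ 2
        = ∑ _σ ∈ B, (ε * (n : ℝ) ^ 2 / 4) ^ 2 := by rw [sum_const, nsmul_eq_mul]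
      _ ≤ ∑ σ ∈ B, (∑ p, inversionSign σ p) ^ 2 := sum_le_sum hdev
      _ ≤ ∑ σ : Equiv.Perm (Fin n), (∑ p, inversionSign σ p) ^ 2 :=
        sum_le_univ_sum_of_nonneg fun σ => sq_nonneg _
      _ ≤ _ := sum_sq_sum_inversionSign_le n
  have hf : (0 : ℝ) < n.factorial := by positivity
  rw [div_div, div_le_div_iff₀ hf (by positivity)]
  have hn3 : (0 : ℝ) < (n : ℝ) ^ 3 := by positivity
  refine le_of_mul_le_mul_right ?_ hn3
  nlinarith [hcheb]

open Finset in
theorem numDerange_eq_numDerangements (n : ℕ) : numDerange n = numDerangements n := by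
  rw [← card_derangements_fin_eq_numDerangements, Fintype.card_subtype]
  refine congrArg card (Finset.ext fun σ => ?_)
  simp only [derangeSet, mem_filter, mem_univ, true_and]
  exact Iff.rfl

open scoped Classical in
/-- Weak law of large numbers for the inversion statistic on random derangements. -/
theorem stmt6 (ε : ℝ) (hε : 0 < ε) :
    Filter.Tendsto
      (fun n => (((derangeSet n).filter
            (fun σ => (1 - ε) * (n : ℝ) ^ 2 / 4 ≤ (inversions σ : ℝ) ∧
              (inversions σ : ℝ) ≤ (1 + ε) * (n : ℝ) ^ 2 / 4)).card : ℝ) /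
        (numDerange n : ℝ))
      Filter.atTop (nhds 1) := by
  have hden : Filter.Tendsto (fun n => (numDerange n : ℝ) / n.factorial) Filter.atTop
      (nhds (Real.exp (-1))) := by
    simpa only [numDerange_eq_numDerangements] using numDerangements_tendsto_inv_e
  have hlower : Filter.Tendsto
      (fun n : ℕ => 1 - 64 / ε ^ 2 / (n : ℝ) / ((numDerange n : ℝ) / n.factorial))
      Filter.atTop (nhds 1) := by
    simpa using (tendsto_const_nhds (x := (1 : ℝ))).sub
      ((tendsto_const_div_atTop_nhds_zero_nat (64 / ε ^ 2)).div hden (Real.exp_pos _).ne')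
  have hlarge : ∀ᶠ n : ℕ in Filter.atTop, 2 ≤ ε * (n : ℝ) :=
    (tendsto_natCast_atTop_atTop.const_mul_atTop hε).eventually_ge_atTop 2
  refine tendsto_of_tendsto_of_tendsto_of_le_of_le' hlower tendsto_const_nhds ?_
    (Filter.Eventually.of_forall fun n => div_le_one_of_le₀
      (by exact_mod_cast Finset.card_filter_le _ _) (Nat.cast_nonneg _))
  filter_upwards [hlarge, hden.eventually (lt_mem_nhds (Real.exp_pos _))] with n hn hd
  have hf : (0 : ℝ) < n.factorial := by positivity
  have hd' : (0 : ℝ) < numDerange n := by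
    simpa [hf.ne'] using mul_pos hd hf
  have hsplit := Finset.card_filter_add_card_filter_not (s := derangeSet n)
    (fun σ => (1 - ε) * (n : ℝ) ^ 2 / 4 ≤ (inversions σ : ℝ) ∧
      (inversions σ : ℝ) ≤ (1 + ε) * (n : ℝ) ^ 2 / 4)
  have hbad := Finset.card_le_card (Finset.filter_subset_filter
    (fun σ => ¬ ((1 - ε) * (n : ℝ) ^ 2 / 4 ≤ (inversions σ : ℝ) ∧
      (inversions σ : ℝ) ≤ (1 + ε) * (n : ℝ) ^ 2 / 4)) (Finset.subset_univ (derangeSet n)))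
  have hdev := card_inversions_deviation_le hε hn
  rw [div_le_iff₀ hf] at hdev
  rw [le_div_iff₀ hd', sub_mul, one_mul, div_div_eq_mul_div, div_mul_cancel₀ _ hd'.ne']
  have hsplit' := congrArg (Nat.cast : ℕ → ℝ) hsplit
  have hbad' := (Nat.cast_le (α := ℝ)).mpr hbad
  push_cast at hsplit'
  unfold numDerange
  linarith
end

section
/- For every integer n ≥ 2 and all integers i, j with 1 ≤ i < j ≤ n, the position of i under a uniformly random derangement strictly stochastically dominates the position of j: for every a ∈ {1,…,n}, #{σ ∈ D_n : σ⁻¹(i) ≥ a} ≥ #{σ ∈ D_n : σ⁻¹(j) ≥ a}, and this inequality is strict for at least one a ∈ {1,…,n}. -/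
open Equiv in
theorem mem_derangeSet {n : ℕ} {σ : Perm (Fin n)} : σ ∈ derangeSet n ↔ ∀ x, σ x ≠ x := by
  simp [derangeSet]

open Equiv in
theorem conj_mem_derangeSet {n : ℕ} {σ : Perm (Fin n)} (τ : Perm (Fin n))
    (hσ : σ ∈ derangeSet n) : τ * σ * τ⁻¹ ∈ derangeSet n := by
  rw [mem_derangeSet] at hσ ⊢
  intro x hx
  apply hσ (τ⁻¹ x)
  rw [Perm.eq_inv_iff_eq]
  exact hx

open Equiv in
theorem finRotate_mem_derangeSet (n : ℕ) : finRotate (n + 2) ∈ derangeSet (n + 2) := by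
  rw [mem_derangeSet]
  intro x
  rw [finRotate_apply]
  simp

open Equiv in
/-- Any two distinct points are linked by some derangement. -/
theorem exists_mem_derangeSet_apply_eq {n : ℕ} {p q : Fin n} (hpq : q ≠ p) :
    ∃ σ ∈ derangeSet n, σ p = q := by
  obtain ⟨m, rfl⟩ : ∃ m, n = m + 2 := ⟨n - 2, by omega⟩
  have hρ := finRotate_mem_derangeSet m
  refine ⟨_, conj_mem_derangeSet (swap (finRotate (m + 2) p) q) hρ, ?_⟩
  have hp : swap (finRotate (m + 2) p) q p = p :=
    swap_apply_of_ne_of_ne (mem_derangeSet.1 hρ p).symm hpq.symm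
  rw [Perm.mul_apply, Perm.mul_apply, swap_inv, hp, swap_apply_left]

open Equiv in
/-- Conjugation by `swap p q` sends a derangement with `q` in position at least `a` to one
with `p` in position at least `a`. -/
theorem image_conj_swap_subset {n : ℕ} {p q : Fin n} (hpq : p < q) (a : ℕ) :
    ((derangeSet n).filter (fun σ => a ≤ ((σ⁻¹ q : Fin n) : ℕ) + 1)).image
        (MulAut.conj (swap p q)) ⊆
      (derangeSet n).filter (fun σ => a ≤ ((σ⁻¹ p : Fin n) : ℕ) + 1) := by
  intro ρ hρ
  obtain ⟨σ, hσ, rfl⟩ := Finset.mem_image.1 hρ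
  obtain ⟨hd, ha⟩ := Finset.mem_filter.1 hσ
  refine Finset.mem_filter.2 ⟨conj_mem_derangeSet _ hd, ?_⟩
  have hq : σ⁻¹ q ≠ q := fun h => mem_derangeSet.1 hd q (Perm.inv_eq_iff_eq.1 h).symm
  rw [← map_inv, MulAut.conj_apply, Perm.mul_apply, Perm.mul_apply, swap_inv, swap_apply_left]
  by_cases hp : σ⁻¹ q = p
  · rw [hp] at ha ⊢
    rw [swap_apply_left]
    have : (p : ℕ) < q := hpq
    omega
  · rwa [swap_apply_of_ne_of_ne hp hq]

open Equiv in
theorem card_filter_position_le {n : ℕ} {p q : Fin n} (hpq : p < q) (a : ℕ) :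
    ((derangeSet n).filter (fun σ => a ≤ ((σ⁻¹ q : Fin n) : ℕ) + 1)).card ≤
      ((derangeSet n).filter (fun σ => a ≤ ((σ⁻¹ p : Fin n) : ℕ) + 1)).card := by
  rw [← Finset.card_image_of_injective _ (MulAut.conj (swap p q)).injective]
  exact Finset.card_le_card (image_conj_swap_subset hpq a)

open Equiv in
theorem card_filter_position_lt {n : ℕ} {p q : Fin n} (hpq : p < q) :
    ((derangeSet n).filter (fun σ => (q : ℕ) + 1 ≤ ((σ⁻¹ q : Fin n) : ℕ) + 1)).card <
      ((derangeSet n).filter (fun σ => (q : ℕ) + 1 ≤ ((σ⁻¹ p : Fin n) : ℕ) + 1)).card := by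
  rw [← Finset.card_image_of_injective _ (MulAut.conj (swap p q)).injective]
  refine Finset.card_lt_card ((Finset.ssubset_iff_of_subset (image_conj_swap_subset hpq _)).2 ?_)
  obtain ⟨ρ, hρ, hρq⟩ := exists_mem_derangeSet_apply_eq hpq.ne
  have hinv : ρ⁻¹ p = q := Perm.inv_eq_iff_eq.2 hρq.symm
  refine ⟨ρ, Finset.mem_filter.2 ⟨hρ, by rw [hinv]⟩, fun hmem => ?_⟩
  obtain ⟨σ, hσ, rfl⟩ := Finset.mem_image.1 hmem
  have ha := (Finset.mem_filter.1 hσ).2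
  rw [← map_inv, MulAut.conj_apply, Perm.mul_apply, Perm.mul_apply, swap_inv, swap_apply_left,
    swap_apply_eq_iff, swap_apply_right] at hinv
  rw [hinv] at ha
  have : (p : ℕ) < q := hpq
  omega

/-- For `i < j`, the (1-based) position of `i` in a uniformly random derangement
strictly stochastically dominates the position of `j`. -/
theorem stmt9 (n i j : ℕ) (hn : 2 ≤ n) (hi : 1 ≤ i) (hij : i < j) (hj : j ≤ n) :
    (∀ a : ℕ, 1 ≤ a → a ≤ n →
        ((derangeSet n).filter
            (fun σ => a ≤ ((σ⁻¹ (⟨i - 1, by omega⟩ : Fin n) : Fin n) : ℕ) + 1)).card ≥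
        ((derangeSet n).filter
            (fun σ => a ≤ ((σ⁻¹ (⟨j - 1, by omega⟩ : Fin n) : Fin n) : ℕ) + 1)).card) ∧
    (∃ a : ℕ, 1 ≤ a ∧ a ≤ n ∧
        ((derangeSet n).filter
            (fun σ => a ≤ ((σ⁻¹ (⟨i - 1, by omega⟩ : Fin n) : Fin n) : ℕ) + 1)).card >
        ((derangeSet n).filter
            (fun σ => a ≤ ((σ⁻¹ (⟨j - 1, by omega⟩ : Fin n) : Fin n) : ℕ) + 1)).card) := by
  have hlt : (⟨i - 1, by omega⟩ : Fin n) < ⟨j - 1, by omega⟩ := by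
    rw [Fin.mk_lt_mk]
    omega
  refine ⟨fun a _ _ => card_filter_position_le hlt a, j, by omega, hj, ?_⟩
  have h := card_filter_position_lt hlt
  simpa only [Nat.sub_add_cancel (show 1 ≤ j by omega)] using h
end
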